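/- arXiv:1602.01635 — 3 statements merged into one kernel-verified Lean document; each statement's English description precedes it below -/
import Mathlib

section
/- Let U be a set and let ⟦n⟧, ⟦vp⟧ ⊆ U be fixed subsets, and let ⟦d⟧ : 𝒫(U) → 𝒫(𝒫(U)) be a function. Define the following relations between sets: n̄ ⊆ {⋆} × 𝒫(U) by ⋆ n̄ A iff A = ⟦n⟧; v̄p ⊆ {⋆} × 𝒫(U) by ⋆ v̄p A iff A = ⟦vp⟧; δ ⊆ 𝒫(U) × (𝒫(U) × 𝒫(U)) by A δ (B,C) iff A = B = C; μ ⊆ (𝒫(U) × 𝒫(U)) × 𝒫(U) by (A,B) μ C iff A ∩ B = C; d̄ ⊆ 𝒫(U) × 𝒫(U) by A d̄ B iff B ∈ ⟦d⟧(A); and ε ⊆ (𝒫(U) × 𝒫(U)) × {⋆} by (A,B) ε ⋆ iff A = B. Then the composite relation ε ∘ (d̄ × μ) ∘ (δ × id) ∘ (n̄ × v̄p) ⊆ {⋆} × {⋆} relates ⋆ to ⋆ if and only if ⟦n⟧ ∩ ⟦vp⟧ ∈ ⟦d⟧(⟦n⟧). -/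
/-- Composition of relations: first `R`, then `S`. -/
def relComp {X Y Z : Type*} (R : X → Y → Prop) (S : Y → Z → Prop) : X → Z → Prop :=
  fun x z => ∃ y, R x y ∧ S y z

/-- Product of relations. -/
def relProd {X X' Y Y' : Type*} (R : X → Y → Prop) (S : X' → Y' → Prop) :
    X × X' → Y × Y' → Prop :=
  fun p q => R p.1 q.1 ∧ S p.2 q.2

/-- Identity relation. -/
def relId {X : Type*} : X → X → Prop := Eq

/-- Graph of a function, viewed as a relation (used for the structural
associativity isomorphisms of the cartesian product in `Rel`). -/
def relOfFun {X Y : Type*} (f : X → Y) : X → Y → Prop := fun x y => y = f x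

/-- The relational semantics of a quantified sentence `Det N VP`:
`ε ∘ (d̄ × μ) ∘ (δ × id) ∘ (n̄ × v̄p)` relates `⋆` to `⋆` iff
`⟦n⟧ ∩ ⟦vp⟧ ∈ ⟦d⟧(⟦n⟧)`. -/
theorem rel_semantics_det_n_vp {U : Type*} (n vp : Set U) (d : Set U → Set (Set U)) :
    (let nbar : Unit → Set U → Prop := fun _ A => A = n
     let vpbar : Unit → Set U → Prop := fun _ A => A = vp
     let δ : Set U → Set U × Set U → Prop := fun A p => A = p.1 ∧ A = p.2
     let μ : Set U × Set U → Set U → Prop := fun p C => p.1 ∩ p.2 = C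
     let dbar : Set U → Set U → Prop := fun A B => B ∈ d A
     let ε : Set U × Set U → Unit → Prop := fun p _ => p.1 = p.2
     -- associator ((W × W) × W) ≅ (W × (W × W))
     let assoc : (Set U × Set U) × Set U → Set U × (Set U × Set U) → Prop :=
       relOfFun (fun p => (p.1.1, (p.1.2, p.2)))
     relComp (relProd nbar vpbar)
       (relComp (relProd δ relId)
         (relComp assoc
           (relComp (relProd dbar μ) ε))) ((), ()) ())
    ↔ n ∩ vp ∈ d n := by
  constructor
  · rintro ⟨⟨_, _⟩, ⟨rfl, rfl⟩, ⟨⟨_, _⟩, _⟩, ⟨⟨rfl, rfl⟩, rfl⟩, _, rfl, ⟨_, _⟩, ⟨hd, rfl⟩, hε⟩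
    exact Eq.subst (motive := (· ∈ d _)) hε hd
  · intro h
    exact ⟨(n, vp), ⟨rfl, rfl⟩, ((n, n), vp), ⟨⟨rfl, rfl⟩, rfl⟩, (n, (n, vp)), rfl,
      (n ∩ vp, n ∩ vp), ⟨h, rfl⟩, rfl⟩
end

section
/- Let U be a set, ⟦np⟧, ⟦n⟧ ⊆ U fixed subsets, ⟦v⟧ ⊆ U × U a binary relation, and ⟦d⟧ : 𝒫(U) → 𝒫(𝒫(U)) a function. Write ⟦v⟧(A) = { y ∈ U | ∃ x ∈ A, (x,y) ∈ ⟦v⟧ } for the forward image. Define relations: n̄p ⊆ {⋆} × 𝒫(U) by ⋆ n̄p A iff A = ⟦np⟧; v̄ ⊆ {⋆} × (𝒫(U) × 𝒫(U)) by ⋆ v̄ (A,B) iff ⟦v⟧(A) = B; n̄ ⊆ {⋆} × 𝒫(U) by ⋆ n̄ A iff A = ⟦n⟧; δ by A δ (B,C) iff A = B = C; μ by (A,B) μ C iff A ∩ B = C; d̄ by A d̄ B iff B ∈ ⟦d⟧(A); and ε by (A,B) ε ⋆ iff A = B. Then the composite relation ε ∘ (μ × d̄) ∘ (ε × id × δ)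 ∘ (n̄p × v̄ × n̄) ⊆ {⋆} × {⋆} relates ⋆ to ⋆ if and only if ⟦v⟧(⟦np⟧) ∩ ⟦n⟧ ∈ ⟦d⟧(⟦n⟧). -/
/-- Forward image of a binary relation `v ⊆ U × U` on a set `A`. -/
def fwdImage {U : Type*} (v : Set (U × U)) (A : Set U) : Set U :=
  {y | ∃ x ∈ A, (x, y) ∈ v}

/-- The relational semantics of a quantified sentence `NP V Det N`:
`ε ∘ (μ × d̄) ∘ (ε × id × δ) ∘ (n̄p × v̄ × n̄)` relates `⋆` to `⋆` iff
`⟦v⟧(⟦np⟧) ∩ ⟦n⟧ ∈ ⟦d⟧(⟦n⟧)`. -/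
theorem rel_semantics_np_v_det_n {U : Type*} (np n : Set U) (v : Set (U × U))
    (d : Set U → Set (Set U)) :
    (let npbar : Unit → Set U → Prop := fun _ A => A = np
     let vbar : Unit → Set U × Set U → Prop := fun _ p => fwdImage v p.1 = p.2
     let nbar : Unit → Set U → Prop := fun _ A => A = n
     let δ : Set U → Set U × Set U → Prop := fun A p => A = p.1 ∧ A = p.2
     let μ : Set U × Set U → Set U → Prop := fun p C => p.1 ∩ p.2 = C
     let dbar : Set U → Set U → Prop := fun A B => B ∈ d A
     let ε : Set U × Set U → Unit → Prop := fun p _ => p.1 = p.2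
     -- regrouping W × ((W × W) × W) ≅ (W × W) × (W × W)
     let regroup₁ : Set U × ((Set U × Set U) × Set U) →
         (Set U × Set U) × (Set U × Set U) → Prop :=
       relOfFun (fun p => ((p.1, p.2.1.1), (p.2.1.2, p.2.2)))
     -- regrouping {⋆} × (W × (W × W)) ≅ (W × W) × W
     let regroup₂ : Unit × (Set U × (Set U × Set U)) →
         (Set U × Set U) × Set U → Prop :=
       relOfFun (fun p => ((p.2.1, p.2.2.1), p.2.2.2))
     relComp (relProd npbar (relProd vbar nbar))
       (relComp regroup₁
         (relComp (relProd ε (relProd relId δ))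
           (relComp regroup₂
             (relComp (relProd μ dbar) ε)))) ((), ((), ())) ())
    ↔ fwdImage v np ∩ n ∈ d n := by
  constructor
  · rintro ⟨⟨A, ⟨B, C⟩, D⟩, ⟨rfl, hv, rfl⟩, _, rfl, ⟨_, E, F, G⟩,
      ⟨hε, rfl, rfl, rfl⟩, _, rfl, ⟨_, _⟩, ⟨rfl, hd⟩, hK⟩
    dsimp only at hε hv hd hK ⊢
    rw [hε, hv, hK]
    exact hd
  · intro h
    exact ⟨(np, (np, fwdImage v np), n), ⟨rfl, rfl, rfl⟩, _, rfl,
      ((), fwdImage v np, n, n), ⟨rfl, rfl, rfl, rfl⟩, _, rfl,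
      (fwdImage v np ∩ n, fwdImage v np ∩ n), ⟨rfl, h⟩, rfl⟩
end

section
/- Let U be a finite set, ⟦n⟧, ⟦vp⟧ ⊆ U fixed subsets, and ⟦d⟧ : 𝒫(U) → 𝒫(𝒫(U)) a function. Let V be the real vector space freely generated by 𝒫(U), with orthonormal basis { |A⟩ : A ⊆ U }. Define linear maps on basis vectors: δ : V → V ⊗ V by δ|A⟩ = |A⟩ ⊗ |A⟩; μ : V ⊗ V → V by μ(|A⟩ ⊗ |B⟩) = |A ∩ B⟩; d̄ : V → V by d̄|A⟩ = Σ_{B ∈ ⟦d⟧(A)} |B⟩; ε : V ⊗ V → ℝ by ε(|A⟩ ⊗ |B⟩) = ⟨A|B⟩ (equal to 1 if A = B and 0 otherwise); and n̄, v̄p : ℝ → V by n̄(1) = |⟦n⟧⟩, v̄p(1) = |⟦vp⟧⟩. Then ε ∘ (d̄ ⊗ μ) ∘ (δ ⊗ id_V) ∘ (n̄ ⊗ v̄p) applied to 1 equals Σ_{B ∈ ⟦d⟧(⟦n⟧)} ⟨B | ⟦n⟧ ∩ ⟦vp⟧⟩, and this scalar is nonzero if and only if ⟦n⟧ ∩ ⟦vp⟧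 ∈ ⟦d⟧(⟦n⟧). -/
open TensorProduct

noncomputable section

/-- The free real vector space over `𝒫(U)`. -/
abbrev FreeV (U : Type*) : Type _ := Set U →₀ ℝ

variable {U : Type*}

/-- The basis vector `|A⟩` of the free vector space over `𝒫(U)`. -/
def ket (A : Set U) : FreeV U := Finsupp.single A 1

/-- The copying comultiplication `δ |A⟩ = |A⟩ ⊗ |A⟩`. -/
def deltaMap (U : Type*) : FreeV U →ₗ[ℝ] FreeV U ⊗[ℝ] FreeV U :=
  Finsupp.lift _ ℝ (Set U) (fun A => ket A ⊗ₜ ket A)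

/-- The intersection multiplication `μ (|A⟩ ⊗ |B⟩) = |A ∩ B⟩`. -/
def muMap (U : Type*) : FreeV U ⊗[ℝ] FreeV U →ₗ[ℝ] FreeV U :=
  TensorProduct.lift (Finsupp.lift _ ℝ (Set U)
    (fun A => Finsupp.lift (FreeV U) ℝ (Set U) (fun B => ket (A ∩ B))))

open Classical in
/-- The inner product `ε (|A⟩ ⊗ |B⟩) = ⟨A|B⟩`. -/
def epsMap (U : Type*) : FreeV U ⊗[ℝ] FreeV U →ₗ[ℝ] ℝ :=
  TensorProduct.lift (Finsupp.lift _ ℝ (Set U)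
    (fun A => Finsupp.lift ℝ ℝ (Set U) (fun B => if A = B then (1:ℝ) else 0)))

/-- The interpretation of the determiner: `d̄ |A⟩ = Σ_{B ∈ ⟦d⟧(A)} |B⟩`. -/
def dbarMap [Finite U] (d : Set U → Set (Set U)) : FreeV U →ₗ[ℝ] FreeV U :=
  Finsupp.lift _ ℝ (Set U) (fun A => ∑ B ∈ (Set.toFinite (d A)).toFinset, ket B)

/-- The interpretation of a noun/noun phrase/verb phrase `x`: `x̄ (1) = |⟦x⟧⟩`. -/
def wordMap (A : Set U) : ℝ →ₗ[ℝ] FreeV U :=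
  LinearMap.toSpanSingleton ℝ (FreeV U) (ket A)

@[simp]
theorem deltaMap_ket (A : Set U) : deltaMap U (ket A) = ket A ⊗ₜ[ℝ] ket A := by
  simp [deltaMap, ket]

@[simp]
theorem muMap_ket_tmul_ket (A B : Set U) :
    muMap U (ket A ⊗ₜ[ℝ] ket B) = ket (A ∩ B) := by
  simp [muMap, ket]

open Classical in
@[simp]
theorem epsMap_ket_tmul_ket (A B : Set U) :
    epsMap U (ket A ⊗ₜ[ℝ] ket B) = if A = B then (1 : ℝ) else 0 := by
  simp +contextual [epsMap, ket, eq_comm]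

@[simp]
theorem dbarMap_ket [Finite U] (d : Set U → Set (Set U)) (A : Set U) :
    dbarMap d (ket A) = ∑ B ∈ (Set.toFinite (d A)).toFinset, ket B := by
  simp [dbarMap, ket]

@[simp]
theorem wordMap_one (A : Set U) : wordMap A 1 = ket A := by
  simp [wordMap]

open Classical in
/-- The boolean `FdVect` semantics of a quantified sentence `Det N VP`:
`ε ∘ (d̄ ⊗ μ) ∘ (δ ⊗ id) ∘ (n̄ ⊗ v̄p)` applied to `1` equals
`Σ_{B ∈ ⟦d⟧(⟦n⟧)} ⟨B | ⟦n⟧ ∩ ⟦vp⟧⟩`, and it is nonzero iff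
`⟦n⟧ ∩ ⟦vp⟧ ∈ ⟦d⟧(⟦n⟧)`. -/
theorem fdvect_semantics_det_n_vp [Finite U] (n vp : Set U) (d : Set U → Set (Set U)) :
    (let F : ℝ →ₗ[ℝ] ℝ :=
      epsMap U
        ∘ₗ TensorProduct.map (dbarMap d) (muMap U)
        ∘ₗ (TensorProduct.assoc ℝ (FreeV U) (FreeV U) (FreeV U)).toLinearMap
        ∘ₗ TensorProduct.map (deltaMap U) LinearMap.id
        ∘ₗ TensorProduct.map (wordMap n) (wordMap vp)
        ∘ₗ (TensorProduct.lid ℝ ℝ).symm.toLinearMap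
     (F 1 = ∑ B ∈ (Set.toFinite (d n)).toFinset, (if B = n ∩ vp then (1:ℝ) else 0)) ∧
     (F 1 ≠ 0 ↔ n ∩ vp ∈ d n)) := by
  intro F
  have hF : F 1 = ∑ B ∈ (Set.toFinite (d n)).toFinset,
      (if B = n ∩ vp then (1 : ℝ) else 0) := by
    simp only [F, LinearMap.comp_apply, LinearEquiv.coe_coe, TensorProduct.lid_symm_apply,
      TensorProduct.map_tmul, wordMap_one, deltaMap_ket, LinearMap.id_apply,
      TensorProduct.assoc_tmul, dbarMap_ket, muMap_ket_tmul_ket, TensorProduct.sum_tmul,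
      map_sum, epsMap_ket_tmul_ket]
  refine ⟨hF, ?_⟩
  rw [hF, Finset.sum_ite_eq']
  simp

end
end
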